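/- For any two nonzero octonions x and y, with c = (y⁻¹x⁻¹)(yx) the multiplicative commutator, the product in the opposite order is recovered as xy = (yx)·conj(c), where conj denotes octonion conjugation. -/

import Mathlib

/-!
Octonions `𝕆`, constructed from the quaternions `ℍ = Quaternion ℝ` by the
Cayley–Dickson doubling construction: an octonion is a pair `(a, b)` of
quaternions, with multiplication
  `(a, b) * (c, d) = (a*c - star d * b, d*a + b * star c)`,
conjugation `conj (a, b) = (star a, -b)`, norm `‖(a,b)‖ = √(‖a‖² + ‖b‖²)`,
and inverse `x⁻¹ = conj x / ‖x‖²` (with `0⁻¹ = 0`).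
-/

noncomputable section

/-- The octonions, as Cayley–Dickson pairs of real quaternions. -/
@[ext]
structure Octonion : Type where
  a : Quaternion ℝ
  b : Quaternion ℝ

namespace Octonion

instance : Zero Octonion := ⟨⟨0, 0⟩⟩
instance : One Octonion := ⟨⟨1, 0⟩⟩

/-- Cayley–Dickson multiplication of octonions. -/
instance : Mul Octonion :=
  ⟨fun x y => ⟨x.a * y.a - star y.b * x.b, y.b * x.a + x.b * star y.a⟩⟩

/-- Octonion conjugation. -/
def conj (x : Octonion) : Octonion := ⟨star x.a, -x.b⟩

/-- The (multiplicative) Euclidean norm of an octonion. -/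
instance : Norm Octonion := ⟨fun x => Real.sqrt (‖x.a‖ ^ 2 + ‖x.b‖ ^ 2)⟩

/-- The two-sided multiplicative inverse `x⁻¹ = conj x / ‖x‖²` (and `0⁻¹ = 0`). -/
instance : Inv Octonion :=
  ⟨fun x => ⟨(‖x‖ ^ 2)⁻¹ • (conj x).a, (‖x‖ ^ 2)⁻¹ • (conj x).b⟩⟩

end Octonion

namespace Octonion

def sm (r : ℝ) (x : Octonion) : Octonion := ⟨r • x.a, r • x.b⟩

def nsq (x : Octonion) : ℝ :=
  x.a.re ^ 2 + x.a.imI ^ 2 + x.a.imJ ^ 2 + x.a.imK ^ 2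
    + (x.b.re ^ 2 + x.b.imI ^ 2 + x.b.imJ ^ 2 + x.b.imK ^ 2)

theorem mul_def' (x y : Octonion) :
    x * y = ⟨x.a * y.a - star y.b * x.b, y.b * x.a + x.b * star y.a⟩ := rfl

theorem norm_sq' (x : Octonion) : ‖x‖ ^ 2 = nsq x := by
  change Real.sqrt (‖x.a‖ ^ 2 + ‖x.b‖ ^ 2) ^ 2 = _
  rw [Real.sq_sqrt (by positivity), pow_two, pow_two, ← Quaternion.normSq_eq_norm_mul_self,
    ← Quaternion.normSq_eq_norm_mul_self, Quaternion.normSq_def', Quaternion.normSq_def']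
  rfl

theorem inv_eq' (x : Octonion) : x⁻¹ = sm (nsq x)⁻¹ (conj x) := by
  rw [← norm_sq']; rfl

theorem nsq_ne {x : Octonion} (hx : x ≠ 0) : nsq x ≠ 0 := by
  intro h
  apply hx
  unfold nsq at h
  apply Octonion.ext <;> apply Quaternion.ext <;> apply pow_eq_zero_iff (two_ne_zero) |>.1 <;>
    apply le_antisymm _ (sq_nonneg _) <;>
    nlinarith [sq_nonneg x.a.re, sq_nonneg x.a.imI, sq_nonneg x.a.imJ, sq_nonneg x.a.imK,
      sq_nonneg x.b.re, sq_nonneg x.b.imI, sq_nonneg x.b.imJ, sq_nonneg x.b.imK]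

theorem conj_mul' (x y : Octonion) : conj (x * y) = conj y * conj x := by
  simp only [mul_def', conj]
  apply Octonion.ext <;> simp [neg_add, add_comm]

theorem conj_conj' (x : Octonion) : conj (conj x) = x := by
  simp [conj]

theorem conj_sm (r : ℝ) (x : Octonion) : conj (sm r x) = sm r (conj x) := by
  simp [conj, sm]

theorem sm_mul (r : ℝ) (x y : Octonion) : sm r x * y = sm r (x * y) := by
  simp [mul_def', sm, smul_sub, smul_add]

theorem mul_sm (r : ℝ) (x y : Octonion) : x * sm r y = sm r (x * y) := by
  simp [mul_def', sm, smul_sub, smul_add]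

theorem sm_sm (r s : ℝ) (x : Octonion) : sm r (sm s x) = sm (r * s) x := by
  simp [sm, smul_smul]

theorem nsq_mul (x y : Octonion) : nsq (x * y) = nsq x * nsq y := by
  simp only [mul_def', nsq, Quaternion.re_sub, Quaternion.imI_sub, Quaternion.imJ_sub,
    Quaternion.imK_sub, Quaternion.re_add, Quaternion.imI_add, Quaternion.imJ_add,
    Quaternion.imK_add, Quaternion.re_mul, Quaternion.imI_mul, Quaternion.imJ_mul,
    Quaternion.imK_mul, Quaternion.re_star, Quaternion.imI_star, Quaternion.imJ_star,
    Quaternion.imK_star]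
  ring

theorem mul_conj_mul (z w : Octonion) : z * (conj z * w) = sm (nsq z) w := by
  apply Octonion.ext <;> apply Quaternion.ext <;>
  simp only [mul_def', nsq, conj, sm, Quaternion.re_sub, Quaternion.imI_sub, Quaternion.imJ_sub,
    Quaternion.imK_sub, Quaternion.re_add, Quaternion.imI_add, Quaternion.imJ_add,
    Quaternion.imK_add, Quaternion.re_mul, Quaternion.imI_mul, Quaternion.imJ_mul,
    Quaternion.imK_mul, Quaternion.re_star, Quaternion.imI_star, Quaternion.imJ_star,
    Quaternion.imK_star, Quaternion.re_neg, Quaternion.imI_neg, Quaternion.imJ_neg,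
    Quaternion.imK_neg, Quaternion.re_smul, Quaternion.imI_smul, Quaternion.imJ_smul,
    Quaternion.imK_smul, smul_eq_mul] <;>
  ring

end Octonion

/-- For any two nonzero octonions `x` and `y`, with
`c = (y⁻¹x⁻¹)(yx)` the multiplicative commutator, the product in the opposite
order is recovered as `xy = (yx) · conj c`. -/
theorem octonion_commutator_reverse (x y : Octonion) (hx : x ≠ 0) (hy : y ≠ 0) :
    x * y = (y * x) * Octonion.conj ((y⁻¹ * x⁻¹) * (y * x)) := by
  have h1 := Octonion.nsq_ne hx
  have h2 := Octonion.nsq_ne hy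
  rw [Octonion.inv_eq', Octonion.inv_eq', Octonion.sm_mul, Octonion.mul_sm, Octonion.sm_sm,
    ← Octonion.conj_mul', Octonion.sm_mul, Octonion.conj_sm, Octonion.conj_mul',
    Octonion.conj_conj', Octonion.mul_sm, Octonion.mul_conj_mul, Octonion.sm_sm,
    Octonion.nsq_mul]
  have h : (Octonion.nsq y)⁻¹ * (Octonion.nsq x)⁻¹ * (Octonion.nsq y * Octonion.nsq x) = 1 := by
    field_simp
  rw [h]
  simp [Octonion.sm]
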